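/- arXiv:2311.18562 — 2 statements merged into one kernel-verified Lean document; each statement's English description precedes it below -/
import Mathlib

section
/- Let S ⊆ E_n be a subset, γ : S → 𝒫(E_n) a function and C_γ the associated S-adapted p-cone. Then 𝕂(C_γ) = {x ∈ C_γ : −x ∈ C_γ} is a free ℤ-module of rank n − |S|, and 𝕂(C_γ) is saturated in ℤ^n: for every x ∈ ℤ^n and every integer m ≥ 1, if m·x ∈ 𝕂(C_γ) then x ∈ 𝕂(C_γ). -/
open scoped Pointwise

/-- The sign `δ_A^{(i)}`: `-1` if `i ∈ A`, `1` otherwise. -/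
def sgn {n : ℕ} (A : Finset (ZMod n)) (i : ZMod n) : ℤ := if i ∈ A then -1 else 1

/-- The `p`-expression `F_T^{(d)}(x) = Σ_{i=0}^{n−1} p^i δ_T^{(d+i)} x_{d+i}`. -/
def pExpr (p : ℕ) {n : ℕ} (T : Finset (ZMod n)) (d : ZMod n) (x : ZMod n → ℤ) : ℤ :=
  ∑ i ∈ Finset.range n, (p : ℤ) ^ i * sgn T (d + (i : ZMod n)) * x (d + (i : ZMod n))

/-- The `S`-adapted `p`-cone associated to `γ`. -/
def adapCone (p : ℕ) {n : ℕ} (S : Finset (ZMod n)) (γ : ZMod n → Finset (ZMod n)) :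
    Set (ZMod n → ℤ) :=
  {x | ∀ i ∈ S, pExpr p (γ i) i x ≤ 0}

/-- The vector `ha_{R,S}^{(i)}`. -/
def haVec (p : ℕ) {n : ℕ} (R S : Finset (ZMod n)) (i : ZMod n) : ZMod n → ℤ :=
  (if i ∈ S then (1 : ℤ) else -1) • Pi.single i (1 : ℤ)
    - ((p : ℤ) * sgn R (i - 1)) • Pi.single (i - 1) (1 : ℤ)

/-- Saturation of a subset of `ℤ^n`. -/
def satur {n : ℕ} (C : Set (ZMod n → ℤ)) : Set (ZMod n → ℤ) :=
  {x | ∃ m : ℕ, 1 ≤ m ∧ (m : ℤ) • x ∈ C}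

/-- The cone of partial Hasse invariants `𝒞_{pHa,S}`. -/
def CpHa (p : ℕ) {n : ℕ} [NeZero n] (R S : Finset (ZMod n)) : Set (ZMod n → ℤ) :=
  satur {x | ∃ c : ZMod n → ℤ, (∀ i ∈ S, 0 ≤ c i) ∧ x = ∑ i, c i • haVec p R S i}

/-- The kernel `𝕂_{R,S}`. -/
def haKer (p : ℕ) {n : ℕ} [NeZero n] (R S : Finset (ZMod n)) : Set (ZMod n → ℤ) :=
  satur {x | ∃ c : ZMod n → ℤ, (∀ i ∈ S, c i = 0) ∧ x = ∑ i, c i • haVec p R S i}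

/-- `T` is admissible with respect to `R` and `S`. -/
def Admissible {n : ℕ} (R S T : Finset (ZMod n)) : Prop :=
  ∀ i : ZMod n, i + 1 ∉ S →
    if i ∈ R then (i ∈ T ↔ i + 1 ∈ T) else (i ∈ T ↔ i + 1 ∉ T)

/-- `T` is `i`-positive. -/
def IPositive {n : ℕ} (R T : Finset (ZMod n)) (i : ZMod n) : Prop :=
  i - 1 ∈ T ↔ i - 1 ∈ R

theorem pExpr_add (p : ℕ) {n : ℕ} (T : Finset (ZMod n)) (d : ZMod n) (x y : ZMod n → ℤ) :
    pExpr p T d (x + y) = pExpr p T d x + pExpr p T d y := by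
  simp only [pExpr, Pi.add_apply, mul_add, Finset.sum_add_distrib]

theorem pExpr_smul (p : ℕ) {n : ℕ} (T : Finset (ZMod n)) (d : ZMod n) (c : ℤ)
    (x : ZMod n → ℤ) : pExpr p T d (c • x) = c * pExpr p T d x := by
  simp only [pExpr, Pi.smul_apply, smul_eq_mul, Finset.mul_sum]
  exact Finset.sum_congr rfl fun i _ => by ring

theorem pExpr_neg (p : ℕ) {n : ℕ} (T : Finset (ZMod n)) (d : ZMod n) (x : ZMod n → ℤ) :
    pExpr p T d (-x) = -pExpr p T d x := by
  simp only [pExpr, Pi.neg_apply, mul_neg, Finset.sum_neg_distrib]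

/-- Only the leading term of a `p`-expression survives modulo `p`. -/
theorem pExpr_cast_zmod (p : ℕ) {n : ℕ} [NeZero n] (T : Finset (ZMod n)) (d : ZMod n)
    (x : ZMod n → ℤ) : ((pExpr p T d x : ℤ) : ZMod p) = (sgn T d : ZMod p) * (x d : ZMod p) := by
  rw [pExpr, Int.cast_sum, Finset.sum_eq_single 0]
  · simp
  · intro i _ hi
    simp [hi]
  · intro h
    exact absurd (Finset.mem_range.2 (NeZero.pos n)) h

/-- The linear map whose `d`-th coordinate is the `p`-expression with starting index `d` and
sign set `γ d`. -/
def pExprMap (p : ℕ) {n : ℕ} (γ : ZMod n → Finset (ZMod n)) :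
    (ZMod n → ℤ) →ₗ[ℤ] (ZMod n → ℤ) where
  toFun x d := pExpr p (γ d) d x
  map_add' x y := funext fun d => pExpr_add p (γ d) d x y
  map_smul' c x := funext fun d => pExpr_smul p (γ d) d c x

theorem det_toMatrix'_pExprMap_ne_zero (p : ℕ) (hp : p.Prime) {n : ℕ} [NeZero n]
    (γ : ZMod n → Finset (ZMod n)) : (LinearMap.toMatrix' (pExprMap p γ)).det ≠ 0 := by
  have : Fact p.Prime := ⟨hp⟩
  intro h
  have hdiag : (LinearMap.toMatrix' (pExprMap p γ)).map (Int.castRingHom (ZMod p)) =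
      Matrix.diagonal fun d => ((sgn (γ d) d : ℤ) : ZMod p) := by
    ext d j
    rw [Matrix.map_apply, LinearMap.toMatrix'_apply]
    change ((pExpr p (γ d) d _ : ℤ) : ZMod p) = _
    rw [pExpr_cast_zmod, Matrix.diagonal_apply]
    split_ifs with hdj <;> simp [hdj]
  have hdet : ((LinearMap.toMatrix' (pExprMap p γ)).map (Int.castRingHom (ZMod p))).det = 0 := by
    rw [← RingHom.mapMatrix_apply, ← RingHom.map_det, h, map_zero]
  rw [hdiag, Matrix.det_diagonal, Finset.prod_eq_zero_iff] at hdet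
  obtain ⟨d, -, hd⟩ := hdet
  unfold sgn at hd
  split_ifs at hd <;> simp at hd

/-- The common kernel of some of the coordinates of an endomorphism of `ℤ^ι` with nonzero
determinant has the expected rank. -/
theorem finrank_ker_funLeft_comp {ι : Type*} [Fintype ι] [DecidableEq ι]
    (f : (ι → ℤ) →ₗ[ℤ] (ι → ℤ)) (hf : (LinearMap.toMatrix' f).det ≠ 0) (S : Finset ι) :
    Module.finrank ℤ (LinearMap.ker (LinearMap.funLeft ℤ ℤ ((↑) : S → ι) ∘ₗ f)) =
      Fintype.card ι - S.card := by
  set L := LinearMap.funLeft ℤ ℤ ((↑) : S → ι) ∘ₗ f with hL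
  set D := (LinearMap.toMatrix' f).det with hD
  have hmem (y : S → ℤ) : D • y ∈ LinearMap.range L := by
    obtain ⟨z, rfl⟩ := LinearMap.funLeft_surjective_of_injective ℤ ℤ ((↑) : S → ι)
      Subtype.val_injective y
    refine ⟨(LinearMap.toMatrix' f).adjugate.mulVec z, ?_⟩
    rw [hL, LinearMap.comp_apply, ← LinearMap.toMatrix'_mulVec f, Matrix.mulVec_mulVec,
      Matrix.mul_adjugate, Matrix.smul_mulVec, Matrix.one_mulVec, map_smul]
  have hinj : Function.Injective
      ((D • (LinearMap.id : (S → ℤ) →ₗ[ℤ] (S → ℤ))).codRestrict (LinearMap.range L) hmem) :=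
    fun y z h => smul_right_injective _ hf (congrArg Subtype.val h)
  have hge := LinearMap.finrank_le_finrank_of_injective hinj
  have hle := Submodule.finrank_le (LinearMap.range L)
  have hsum := Submodule.finrank_quotient_add_finrank (LinearMap.ker L)
  rw [L.quotKerEquivRange.finrank_eq] at hsum
  simp only [Module.finrank_fintype_fun_eq_card, Fintype.card_coe] at hge hle hsum
  omega

theorem mem_adapCone_and_neg_mem_iff (p : ℕ) {n : ℕ} (S : Finset (ZMod n))
    (γ : ZMod n → Finset (ZMod n)) (x : ZMod n → ℤ) :
    (x ∈ adapCone p S γ ∧ -x ∈ adapCone p S γ) ↔ ∀ i ∈ S, pExpr p (γ i) i x = 0 := by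
  simp only [adapCone, Set.mem_ofPred_eq, pExpr_neg, Left.neg_nonpos_iff, ← forall₂_and,
    ← le_antisymm_iff]

/-- Corollary 4.19: for an `S`-adapted `p`-cone `C_γ`, the group of invertible elements
`𝕂(C_γ)` is a free `ℤ`-module of rank `n − |S|`, and it is saturated in `ℤ^n`. -/
theorem ker_adapCone_free_rank_and_saturated (p : ℕ) (hp : p.Prime) {n : ℕ} [NeZero n]
    (S : Finset (ZMod n)) (γ : ZMod n → Finset (ZMod n)) :
    (∃ B : Submodule ℤ (ZMod n → ℤ),
        (B : Set (ZMod n → ℤ)) =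
          {x | x ∈ adapCone p S γ ∧ -x ∈ adapCone p S γ} ∧
        Module.Free ℤ ↥B ∧ Module.finrank ℤ ↥B = n - S.card) ∧
    (∀ (x : ZMod n → ℤ) (m : ℕ), 1 ≤ m →
      (m : ℤ) • x ∈ {x | x ∈ adapCone p S γ ∧ -x ∈ adapCone p S γ} →
      x ∈ {x | x ∈ adapCone p S γ ∧ -x ∈ adapCone p S γ}) := by
  simp only [Set.mem_ofPred_eq, mem_adapCone_and_neg_mem_iff]
  refine ⟨⟨LinearMap.ker (LinearMap.funLeft ℤ ℤ ((↑) : S → ZMod n) ∘ₗ pExprMap p γ), ?_,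
    inferInstance, ?_⟩, fun x m hm hx i hi => ?_⟩
  · ext x
    rw [SetLike.mem_coe, LinearMap.mem_ker, funext_iff, Subtype.forall]
    rfl
  · rw [finrank_ker_funLeft_comp _ (det_toMatrix'_pExprMap_ne_zero p hp γ), ZMod.card]
  · have h := hx i hi
    rw [pExpr_smul, mul_eq_zero] at h
    exact h.resolve_left (by omega)
end

section
/- For every parabolic type R ⊆ E_n and every nonempty subset S ⊆ E_n, the intersection-sum cone 𝒞_S^{∩,+} coincides with 𝒞_{R,S}, the unique positive admissible homogeneous S-adapted p-cone. -/
open scoped Pointwise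

/-- Auxiliary fuel-indexed definition of the intersection-sum cones. -/
def ISConeAux (p : ℕ) {n : ℕ} [NeZero n] (R : Finset (ZMod n)) :
    ℕ → Finset (ZMod n) → Set (ZMod n → ℤ)
  | 0, S => CpHa p R S
  | 1, S => CpHa p R S
  | (k + 2), S => satur (CpHa p R S + ⋂ s ∈ S, ISConeAux p R (k + 1) (S.erase s))

/-- The intersection-sum cone `𝒞_S^{∩,+}`: equal to `𝒞_{pHa,S}` when `|S| = 1`, and for
`|S| ≥ 2` the saturation of `𝒞_{pHa,S} + ⋂_{s∈S} 𝒞_{S∖{s}}^{∩,+}` (the recursion is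
implemented with `|S|` as fuel; for `s ∈ S` one has `|S.erase s| = |S| − 1`). -/
def ISCone (p : ℕ) {n : ℕ} [NeZero n] (R S : Finset (ZMod n)) : Set (ZMod n → ℤ) :=
  ISConeAux p R S.card S

lemma sgn_sq {n : ℕ} (A : Finset (ZMod n)) (i : ZMod n) : sgn A i * sgn A i = 1 := by
  unfold sgn; split_ifs <;> norm_num

/-- The `p`-expression as a linear form. -/
def pExprHom (p : ℕ) {n : ℕ} (T : Finset (ZMod n)) (d : ZMod n) : (ZMod n → ℤ) →ₗ[ℤ] ℤ where
  toFun := pExpr p T d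
  map_add' x y := by
    simp only [pExpr, Pi.add_apply, mul_add, Finset.sum_add_distrib]
  map_smul' m x := by
    simp only [pExpr, Pi.smul_apply, smul_eq_mul, Finset.mul_sum, RingHom.id_apply]
    exact Finset.sum_congr rfl fun i _ => by ring

lemma pExprHom_apply (p : ℕ) {n : ℕ} (T : Finset (ZMod n)) (d : ZMod n) (x : ZMod n → ℤ) :
    pExprHom p T d x = pExpr p T d x := rfl

lemma pExpr_eq_add_succ (p : ℕ) {n : ℕ} [NeZero n] (T : Finset (ZMod n)) (d : ZMod n)
    (x : ZMod n → ℤ) :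
    pExpr p T d x = (1 - (p : ℤ) ^ n) * (sgn T d * x d) + p * pExpr p T (d + 1) x := by
  obtain ⟨m, rfl⟩ := Nat.exists_eq_succ_of_ne_zero (NeZero.ne n)
  have hm : d + 1 + (m : ZMod (m + 1)) = d := by
    have := ZMod.natCast_self (m + 1)
    push_cast at this
    rw [add_assoc, add_comm 1, this, add_zero]
  have key : ∀ i : ℕ, d + 1 + (i : ZMod (m + 1)) = d + ((i + 1 : ℕ) : ZMod (m + 1)) := by
    intro i; push_cast; ring
  simp only [pExpr, Nat.succ_eq_add_one]
  rw [Finset.sum_range_succ', Finset.sum_range_succ _ m, hm, mul_add, Finset.mul_sum]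
  simp only [key, Nat.cast_zero, add_zero]
  rw [Finset.sum_congr rfl fun i _ => (by ring :
    (p : ℤ) ^ (i + 1) * sgn T (d + ((i + 1 : ℕ) : ZMod (m + 1))) *
      x (d + ((i + 1 : ℕ) : ZMod (m + 1))) =
    p * (p ^ i * sgn T (d + ((i + 1 : ℕ) : ZMod (m + 1))) *
      x (d + ((i + 1 : ℕ) : ZMod (m + 1)))))]
  ring

lemma pExpr_single (p : ℕ) {n : ℕ} [NeZero n] (T : Finset (ZMod n)) (d j : ZMod n) :
    pExpr p T d (Pi.single j 1) = (p : ℤ) ^ (j - d).val * sgn T j := by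
  have hcast : d + (((j - d).val : ℕ) : ZMod n) = j := by
    rw [ZMod.natCast_zmod_val]; ring
  rw [pExpr, Finset.sum_eq_single_of_mem (j - d).val (Finset.mem_range.2 (ZMod.val_lt _))]
  · rw [hcast]; simp
  · intro i hi hne
    have : d + (i : ZMod n) ≠ j := by
      intro h
      apply hne
      rw [← h, add_sub_cancel_left, ZMod.val_cast_of_lt (Finset.mem_range.1 hi)]
    rw [Pi.single_eq_of_ne this, mul_zero]

lemma ZMod.val_neg_one_add_one (n : ℕ) [NeZero n] : (-1 : ZMod n).val + 1 = n := by
  obtain ⟨m, rfl⟩ := Nat.exists_eq_succ_of_ne_zero (NeZero.ne n)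
  rw [ZMod.val_neg_one]

lemma ZMod.val_sub_one_add_one {n : ℕ} [NeZero n] {a : ZMod n} (ha : a ≠ 0) :
    (a - 1).val + 1 = a.val := by
  have hpos : 0 < a.val := Nat.pos_of_ne_zero fun h => ha ((ZMod.val_eq_zero a).1 h)
  have h : a - 1 = ((a.val - 1 : ℕ) : ZMod n) := by
    rw [Nat.cast_sub hpos, ZMod.natCast_zmod_val, Nat.cast_one]
  rw [h, ZMod.val_cast_of_lt ((Nat.sub_le _ _).trans_lt a.val_lt)]
  omega

lemma pExpr_haVec (p : ℕ) {n : ℕ} [NeZero n] (R S T : Finset (ZMod n)) (d i : ZMod n) :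
    pExpr p T d (haVec p R S i) =
      (if i ∈ S then (1 : ℤ) else -1) * ((p : ℤ) ^ (i - d).val * sgn T i)
        - (p : ℤ) ^ ((i - d - 1).val + 1) * (sgn R (i - 1) * sgn T (i - 1)) := by
  rw [← pExprHom_apply, haVec, map_sub, map_smul, map_smul, pExprHom_apply, pExprHom_apply,
    pExpr_single, pExpr_single, sub_right_comm i 1 d, smul_eq_mul, smul_eq_mul]
  ring

lemma Admissible.sgn_mul {n : ℕ} {R S T : Finset (ZMod n)} (h : Admissible R S T) {i : ZMod n}
    (hi : i ∉ S) : sgn R (i - 1) * sgn T (i - 1) = -sgn T i := by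
  have := h (i - 1) (by simpa using hi)
  rw [sub_add_cancel] at this
  unfold sgn
  split_ifs at this ⊢ <;> simp_all

lemma IPositive.sgn_mul {n : ℕ} {R T : Finset (ZMod n)} {i : ZMod n} (h : IPositive R T i) :
    sgn R (i - 1) * sgn T (i - 1) = 1 := by
  unfold IPositive at h
  unfold sgn
  split_ifs <;> simp_all

lemma pExpr_haVec_of_notMem (p : ℕ) {n : ℕ} [NeZero n] {R S T : Finset (ZMod n)}
    (hT : Admissible R S T) {d i : ZMod n} (hd : d ∈ S) (hi : i ∉ S) :
    pExpr p T d (haVec p R S i) = 0 := by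
  have hne : i - d ≠ 0 := sub_ne_zero.2 (by rintro rfl; exact hi hd)
  rw [pExpr_haVec, if_neg hi, ZMod.val_sub_one_add_one hne, hT.sgn_mul hi]
  ring

lemma pExpr_haVec_of_mem_of_ne (p : ℕ) {n : ℕ} [NeZero n] {R S T : Finset (ZMod n)}
    {d i : ZMod n} (hT : IPositive R T i) (hi : i ∈ S) (hne : i ≠ d) :
    pExpr p T d (haVec p R S i) = (p : ℤ) ^ (i - d).val * (sgn T i - 1) := by
  rw [pExpr_haVec, if_pos hi, ZMod.val_sub_one_add_one (sub_ne_zero.2 hne), hT.sgn_mul]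
  ring

lemma pExpr_haVec_self (p : ℕ) {n : ℕ} [NeZero n] {R S T : Finset (ZMod n)}
    {i : ZMod n} (hT : IPositive R T i) (hi : i ∈ S) :
    pExpr p T i (haVec p R S i) = sgn T i - (p : ℤ) ^ n := by
  rw [pExpr_haVec, if_pos hi, hT.sgn_mul, sub_self, zero_sub, ZMod.val_neg_one_add_one,
    ZMod.val_zero]
  ring

lemma sgn_le_one {n : ℕ} (A : Finset (ZMod n)) (i : ZMod n) : sgn A i ≤ 1 := by
  unfold sgn; split_ifs <;> norm_num

lemma one_lt_natCast_pow {p n : ℕ} (hp : 2 ≤ p) [NeZero n] : (1 : ℤ) < (p : ℤ) ^ n :=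
  one_lt_pow₀ (by exact_mod_cast hp) (NeZero.ne n)

lemma pExpr_haVec_nonpos {p : ℕ} (hp : 2 ≤ p) {n : ℕ} [NeZero n] {R S T : Finset (ZMod n)}
    {d i : ZMod n} (hT : IPositive R T i) (hi : i ∈ S) :
    pExpr p T d (haVec p R S i) ≤ 0 := by
  have hle := sgn_le_one T i
  by_cases hne : i = d
  · subst hne
    rw [pExpr_haVec_self p hT hi]
    linarith [one_lt_natCast_pow (n := n) hp]
  · rw [pExpr_haVec_of_mem_of_ne p hT hi hne]
    exact mul_nonpos_of_nonneg_of_nonpos (by positivity) (by linarith)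

lemma satur_adapCone_subset (p : ℕ) {n : ℕ} (S : Finset (ZMod n))
    (γ : ZMod n → Finset (ZMod n)) : satur (adapCone p S γ) ⊆ adapCone p S γ := by
  rintro x ⟨m, hm, hx⟩ i hi
  have h := hx i hi
  rw [← pExprHom_apply, map_smul, smul_eq_mul] at h
  have hm' : (0 : ℤ) < m := by exact_mod_cast hm
  exact nonpos_of_mul_nonpos_right h hm'

lemma satur_mono {n : ℕ} {C D : Set (ZMod n → ℤ)} (h : C ⊆ D) : satur C ⊆ satur D :=
  fun _ ⟨m, hm, hx⟩ => ⟨m, hm, h hx⟩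

lemma adapCone_add_mem {p n : ℕ} {S : Finset (ZMod n)} {γ : ZMod n → Finset (ZMod n)}
    {x y : ZMod n → ℤ} (hx : x ∈ adapCone p S γ) (hy : y ∈ adapCone p S γ) :
    x + y ∈ adapCone p S γ := by
  intro i hi
  rw [← pExprHom_apply, map_add]
  exact add_nonpos (hx i hi) (hy i hi)

lemma pExpr_sum_haVec (p : ℕ) {n : ℕ} [NeZero n] (R S T : Finset (ZMod n)) (d : ZMod n)
    (c : ZMod n → ℤ) :
    pExpr p T d (∑ i, c i • haVec p R S i) = ∑ i, c i * pExpr p T d (haVec p R S i) := by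
  rw [← pExprHom_apply, map_sum]
  simp only [map_smul, smul_eq_mul, pExprHom_apply]

lemma CpHa_subset_adapCone {p : ℕ} (hp : 2 ≤ p) {n : ℕ} [NeZero n] {R S T : Finset (ZMod n)}
    (hTadm : Admissible R S T) (hTpos : ∀ i ∈ S, IPositive R T i) :
    CpHa p R S ⊆ adapCone p S (fun _ => T) := by
  refine (satur_mono ?_).trans (satur_adapCone_subset p S _)
  rintro _ ⟨c, hc, rfl⟩ d hd
  rw [pExpr_sum_haVec]
  refine Finset.sum_nonpos fun i _ => ?_
  by_cases hi : i ∈ S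
  · exact mul_nonpos_of_nonneg_of_nonpos (hc i hi) (pExpr_haVec_nonpos hp (hTpos i hi) hi)
  · rw [pExpr_haVec_of_notMem p hTadm hd hi, mul_zero]

/-- The vectors `ha_{R,S}^{(i)}` span a sublattice containing `(p^{2n} - 1) ℤ^n`. -/
lemma smul_mem_span_haVec (p : ℕ) {n : ℕ} [NeZero n] (R S : Finset (ZMod n))
    (x : ZMod n → ℤ) :
    ((p : ℤ) ^ n * (p : ℤ) ^ n - 1) • x ∈ Submodule.span ℤ (Set.range (haVec p R S)) := by
  set N := Submodule.span ℤ (Set.range (haVec p R S)) with hN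
  have step : ∀ (i : ZMod n) (k : ℕ), ∃ σ : ℤ, σ * σ = 1 ∧
      (Pi.single (i + k) 1 - (σ * (p : ℤ) ^ k) • Pi.single i 1 : ZMod n → ℤ) ∈ N := by
    intro i k
    induction k with
    | zero => exact ⟨1, by norm_num, by simp⟩
    | succ k ih =>
      obtain ⟨σ, hσ, hmem⟩ := ih
      obtain ⟨ε, hε, hεeq⟩ : ∃ ε : ℤ, ε * ε = 1 ∧
          (if i + k + 1 ∈ S then (1 : ℤ) else -1) = ε :=
        ⟨_, by split_ifs <;> norm_num, rfl⟩
      have hha : haVec p R S (i + k + 1) ∈ N := Submodule.subset_span ⟨_, rfl⟩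
      rw [haVec, hεeq, add_sub_cancel_right] at hha
      have hτ := sgn_sq R (i + k)
      set τ := sgn R (i + k)
      refine ⟨ε * τ * σ, by linear_combination (σ * σ * τ * τ) * hε + σ * σ * hτ + hσ, ?_⟩
      have := N.add_mem (N.smul_mem ε hha) (N.smul_mem (ε * p * τ) hmem)
      convert this using 1
      rw [Nat.cast_succ, ← add_assoc]
      ext j
      simp only [Pi.sub_apply, Pi.add_apply, Pi.smul_apply, smul_eq_mul]
      linear_combination (-(Pi.single (i + k + 1) 1 : ZMod n → ℤ) j) * hε
  have hsingle : ∀ i : ZMod n,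
      ((p : ℤ) ^ n * (p : ℤ) ^ n - 1) • (Pi.single i 1 : ZMod n → ℤ) ∈ N := by
    intro i
    obtain ⟨σ, hσ, hmem⟩ := step i n
    rw [ZMod.natCast_self, add_zero] at hmem
    convert N.smul_mem (-(1 + σ * (p : ℤ) ^ n)) hmem using 1
    ext j
    simp only [Pi.sub_apply, Pi.smul_apply, smul_eq_mul]
    linear_combination (-(p : ℤ) ^ n * (p : ℤ) ^ n * (Pi.single i 1 : ZMod n → ℤ) j) * hσ
  have hx : x = ∑ i, x i • (Pi.single i 1 : ZMod n → ℤ) := by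
    simpa using pi_eq_sum_univ' x
  rw [hx, Finset.smul_sum]
  refine N.sum_mem fun i _ => ?_
  rw [smul_comm]
  exact N.smul_mem _ (hsingle i)

lemma adapCone_singleton_subset_CpHa {p : ℕ} (hp : 2 ≤ p) {n : ℕ} [NeZero n]
    {R T : Finset (ZMod n)} {s : ZMod n} (hTadm : Admissible R {s} T) (hTpos : IPositive R T s) :
    adapCone p {s} (fun _ => T) ⊆ CpHa p R {s} := by
  intro x hx
  obtain ⟨c, hc⟩ := (Submodule.mem_span_range_iff_exists_fun ℤ).1 (smul_mem_span_haVec p R {s} x)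
  have hq := one_lt_natCast_pow (n := n) hp
  have hM : 0 < (p : ℤ) ^ n * (p : ℤ) ^ n - 1 := by nlinarith
  obtain ⟨m, hm⟩ := Int.eq_ofNat_of_zero_le hM.le
  refine ⟨m, by omega, c, ?_, by rw [← hm, hc]⟩
  intro i hi
  obtain rfl := Finset.mem_singleton.1 hi
  have hF := congrArg (pExpr p T i) hc
  rw [pExpr_sum_haVec, Finset.sum_eq_single_of_mem i (Finset.mem_univ i) (fun j _ hj => by
    rw [pExpr_haVec_of_notMem p hTadm hi (by simpa using hj), mul_zero]),
    pExpr_haVec_self p hTpos hi, ← pExprHom_apply, map_smul, pExprHom_apply, smul_eq_mul] at hF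
  have h1 := hx i hi
  have h2 := sgn_le_one T i
  by_contra! hneg
  nlinarith [mul_pos_of_neg_of_neg hneg (by linarith : sgn T i - (p : ℤ) ^ n < 0),
    mul_nonpos_of_nonneg_of_nonpos hM.le h1]

/-- The block `{r, r + 1, …, r + ℓ - 1}`. -/
def cyclicBlock {n : ℕ} (r : ZMod n) (l : ℕ) : Finset (ZMod n) :=
  (Finset.range l).image fun j : ℕ => r + (j : ZMod n)

lemma mem_cyclicBlock {n : ℕ} {r i : ZMod n} {l : ℕ} :
    i ∈ cyclicBlock r l ↔ ∃ j < l, r + (j : ZMod n) = i := by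
  simp [cyclicBlock]

lemma add_natCast_mem_cyclicBlock_iff {n : ℕ} {r : ZMod n} {l j : ℕ} (hl : l ≤ n)
    (hj : j < n) : r + (j : ZMod n) ∈ cyclicBlock r l ↔ j < l := by
  rw [mem_cyclicBlock]
  refine ⟨?_, fun h => ⟨j, h, rfl⟩⟩
  rintro ⟨k, hk, h⟩
  have := congrArg ZMod.val (add_left_cancel h)
  rw [ZMod.val_cast_of_lt (hk.trans_le hl), ZMod.val_cast_of_lt hj] at this
  omega

/-- `s = r + l` is the element of `S` following `r` in the cyclic order, and `s ≠ r`. -/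
structure IsNext {n : ℕ} (S : Finset (ZMod n)) (r s : ZMod n) (l : ℕ) : Prop where
  left_mem : r ∈ S
  right_mem : s ∈ S
  pos : 0 < l
  lt : l < n
  add_eq : r + (l : ZMod n) = s
  notMem : ∀ j : ℕ, 0 < j → j < l → r + (j : ZMod n) ∉ S

lemma exists_pos_lt_minimal {n : ℕ} [NeZero n] {Q : ZMod n → Prop} {a : ZMod n}
    (ha : a ≠ 0) (hQ : Q a) :
    ∃ l : ℕ, 0 < l ∧ l < n ∧ Q l ∧ ∀ j : ℕ, 0 < j → j < l → ¬ Q j := by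
  classical
  have hex : ∃ l : ℕ, 0 < l ∧ Q l :=
    ⟨a.val, Nat.pos_of_ne_zero fun h => ha ((ZMod.val_eq_zero a).1 h),
      by rwa [ZMod.natCast_zmod_val]⟩
  have hle : Nat.find hex ≤ a.val := Nat.find_min' hex
    ⟨Nat.pos_of_ne_zero fun h => ha ((ZMod.val_eq_zero a).1 h),
      by rwa [ZMod.natCast_zmod_val]⟩
  exact ⟨Nat.find hex, (Nat.find_spec hex).1, hle.trans_lt a.val_lt, (Nat.find_spec hex).2,
    fun j hj hlt hQj => Nat.find_min hex hlt ⟨hj, hQj⟩⟩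

lemma exists_isNext_right {n : ℕ} [NeZero n] {S : Finset (ZMod n)} (hS : 1 < S.card)
    {r : ZMod n} (hr : r ∈ S) : ∃ s l, IsNext S r s l := by
  obtain ⟨t, ht, hne⟩ := Finset.exists_mem_ne hS r
  obtain ⟨l, h0, hn, hl, hmin⟩ := exists_pos_lt_minimal (Q := fun a => r + a ∈ S)
    (sub_ne_zero.2 hne) (by simpa using ht)
  exact ⟨r + l, l, hr, hl, h0, hn, rfl, hmin⟩

lemma exists_isNext_left {n : ℕ} [NeZero n] {S : Finset (ZMod n)} (hS : 1 < S.card)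
    {s : ZMod n} (hs : s ∈ S) : ∃ r l, IsNext S r s l := by
  obtain ⟨t, ht, hne⟩ := Finset.exists_mem_ne hS s
  obtain ⟨l, h0, hn, hl, hmin⟩ := exists_pos_lt_minimal (Q := fun a => s - a ∈ S)
    (sub_ne_zero.2 hne.symm) (by simpa using ht)
  refine ⟨s - l, l, hl, hs, h0, hn, by ring, fun j hj hjl => ?_⟩
  have := hmin (l - j) (by omega) (by omega)
  rwa [Nat.cast_sub hjl.le, ← sub_add] at this

namespace IsNext

variable {n : ℕ} {S : Finset (ZMod n)} {r s : ZMod n} {l : ℕ}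

lemma right_notMem (h : IsNext S r s l) : s ∉ cyclicBlock r l := by
  rw [← h.add_eq, add_natCast_mem_cyclicBlock_iff h.lt.le h.lt]
  exact lt_irrefl l

lemma ne (h : IsNext S r s l) : r ≠ s := by
  rintro rfl
  exact h.right_notMem (mem_cyclicBlock.2 ⟨0, h.pos, by simp⟩)

lemma right_sub_one_mem (h : IsNext S r s l) : s - 1 ∈ cyclicBlock r l := by
  refine mem_cyclicBlock.2 ⟨l - 1, by have := h.pos; omega, ?_⟩
  rw [Nat.cast_sub h.pos, ← h.add_eq]
  push_cast
  ring

lemma sub_one_mem_iff (h : IsNext S r s l) {i : ZMod n} (hi : i ∉ S) :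
    i - 1 ∈ cyclicBlock r l ↔ i ∈ cyclicBlock r l := by
  simp only [mem_cyclicBlock]
  constructor
  · rintro ⟨j, hj, hji⟩
    refine ⟨j + 1, ?_, by push_cast; rw [← add_assoc, hji]; ring⟩
    rcases Nat.lt_or_ge (j + 1) l with h' | h'
    · exact h'
    · obtain rfl : l = j + 1 := by omega
      refine absurd ?_ hi
      have := h.add_eq
      push_cast at this
      rw [← add_assoc, hji, sub_add_cancel] at this
      exact this ▸ h.right_mem
  · rintro ⟨j, hj, hji⟩
    rcases Nat.eq_zero_or_pos j with rfl | hpos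
    · refine absurd ?_ hi
      rw [Nat.cast_zero, add_zero] at hji
      exact hji ▸ h.left_mem
    · exact ⟨j - 1, by omega, by rw [Nat.cast_sub hpos, ← hji]; push_cast; ring⟩

lemma sub_one_notMem (h : IsNext S r s l) {i : ZMod n} (hi : i ∈ S) (his : i ≠ s) :
    i - 1 ∉ cyclicBlock r l := by
  rw [mem_cyclicBlock]
  rintro ⟨j, hj, hji⟩
  have hji' : r + ((j + 1 : ℕ) : ZMod n) = i := by
    push_cast; rw [← add_assoc, hji]; ring
  rcases Nat.lt_or_ge (j + 1) l with h' | h'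
  · exact h.notMem (j + 1) (by omega) h' (hji' ▸ hi)
  · obtain rfl : l = j + 1 := by omega
    exact his (hji'.symm.trans h.add_eq)

end IsNext

lemma Admissible.erase_of_mem {n : ℕ} {R S T : Finset (ZMod n)} {s : ZMod n}
    (hTadm : Admissible R S T) (hTpos : IPositive R T s) (hs : s ∈ T) :
    Admissible R (S.erase s) T := by
  intro i hi
  by_cases his : i + 1 = s
  · subst his
    unfold IPositive at hTpos
    rw [add_sub_cancel_right] at hTpos
    split_ifs <;> simp_all
  · exact hTadm i fun h => hi (Finset.mem_erase.2 ⟨his, h⟩)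

lemma mem_symmDiff_iff_of_mem {α : Type*} [DecidableEq α] {T B : Finset α} {i : α}
    (h : i ∈ B) : i ∈ symmDiff T B ↔ i ∉ T := by
  simp [Finset.mem_symmDiff, h]

lemma mem_symmDiff_iff_of_notMem {α : Type*} [DecidableEq α] {T B : Finset α} {i : α}
    (h : i ∉ B) : i ∈ symmDiff T B ↔ i ∈ T := by
  simp [Finset.mem_symmDiff, h]

lemma Admissible.erase_symmDiff {n : ℕ} {R S T : Finset (ZMod n)} {r s : ZMod n} {l : ℕ}
    (hTadm : Admissible R S T) (hTpos : IPositive R T s) (h : IsNext S r s l) (hs : s ∉ T) :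
    Admissible R (S.erase s) (symmDiff T (cyclicBlock r l)) := by
  intro i hi
  by_cases his : i + 1 = s
  · have hb := h.right_sub_one_mem
    have hb' := h.right_notMem
    unfold IPositive at hTpos
    subst his
    rw [add_sub_cancel_right] at hb hTpos
    rw [mem_symmDiff_iff_of_mem hb, mem_symmDiff_iff_of_notMem hb']
    split_ifs <;> simp_all
  · have hiS : i + 1 ∉ S := fun h => hi (Finset.mem_erase.2 ⟨his, h⟩)
    have hT := hTadm i hiS
    have hb := h.sub_one_mem_iff hiS
    rw [add_sub_cancel_right] at hb
    by_cases hiB : i ∈ cyclicBlock r l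
    · rw [mem_symmDiff_iff_of_mem hiB, mem_symmDiff_iff_of_mem (hb.1 hiB)]
      split_ifs at hT ⊢ <;> tauto
    · rwa [mem_symmDiff_iff_of_notMem hiB, mem_symmDiff_iff_of_notMem (mt hb.2 hiB)]

lemma IPositive.symmDiff {n : ℕ} {R S T : Finset (ZMod n)} {r s i : ZMod n} {l : ℕ}
    (hTpos : IPositive R T i) (h : IsNext S r s l) (hi : i ∈ S) (his : i ≠ s) :
    IPositive R (symmDiff T (cyclicBlock r l)) i := by
  unfold IPositive at *
  rwa [mem_symmDiff_iff_of_notMem (h.sub_one_notMem hi his)]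

lemma sgn_symmDiff_of_mem {n : ℕ} {T B : Finset (ZMod n)} {i : ZMod n} (h : i ∈ B) :
    sgn (symmDiff T B) i = -sgn T i := by
  simp only [sgn, mem_symmDiff_iff_of_mem h]
  split_ifs <;> simp_all

lemma sgn_symmDiff_of_notMem {n : ℕ} {T B : Finset (ZMod n)} {i : ZMod n} (h : i ∉ B) :
    sgn (symmDiff T B) i = sgn T i := by
  simp only [sgn, mem_symmDiff_iff_of_notMem h]

lemma eq_pow_mul_of_forall_eq_mul {f : ℕ → ℤ} {q : ℤ} {a k : ℕ}
    (h : ∀ j, a ≤ j → j < a + k → f j = q * f (j + 1)) : f a = q ^ k * f (a + k) := by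
  induction k with
  | zero => simp
  | succ k ih =>
    rw [ih fun j h₁ h₂ => h j h₁ (by omega), h (a + k) (by omega) (by omega), pow_succ, add_assoc]
    ring

/-- The change in `F_T^{(d)}` when the signs are flipped on the block between two consecutive
elements `r`, `s` of `S`. -/
lemma pExpr_symmDiff (p : ℕ) {n : ℕ} [NeZero n] {S T : Finset (ZMod n)} {r s : ZMod n}
    {l : ℕ} (h : IsNext S r s l) {d : ZMod n} (hd : d ∈ S) (x : ZMod n → ℤ) :
    ∃ a : ℕ, (d = r → a = 0) ∧
    ((p : ℤ) ^ n - 1) * (pExpr p T d x - pExpr p (symmDiff T (cyclicBlock r l)) d x) =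
      2 * (p : ℤ) ^ a * ((p : ℤ) ^ l * pExpr p T s x - pExpr p T r x) := by
  set T' := symmDiff T (cyclicBlock r l) with hT'
  set D : ℕ → ℤ := fun j => pExpr p T (r + j) x - pExpr p T' (r + j) x with hD
  have hin := eq_pow_mul_of_forall_eq_mul (f := fun j => D j - 2 * pExpr p T (r + j) x)
    (q := p) (a := 0) (k := l) fun j _ hj => by
      have hB := (add_natCast_mem_cyclicBlock_iff (r := r) h.lt.le
        (by have := h.lt; omega : j < n)).2 (by omega)
      have h₁ := pExpr_eq_add_succ p T (r + j) x
      have h₂ := pExpr_eq_add_succ p T' (r + j) x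
      rw [hT', sgn_symmDiff_of_mem hB, ← hT'] at h₂
      simp only [hD, Nat.cast_succ, ← add_assoc]
      linear_combination -h₁ - h₂
  have hout : ∀ j, l ≤ j → j < n → D j = p * D (j + 1) := fun j hlj hj => by
      have hB := mt (add_natCast_mem_cyclicBlock_iff (r := r) h.lt.le hj).1 (by omega)
      have h₁ := pExpr_eq_add_succ p T (r + j) x
      have h₂ := pExpr_eq_add_succ p T' (r + j) x
      rw [hT', sgn_symmDiff_of_notMem hB, ← hT'] at h₂
      simp only [hD, Nat.cast_succ, ← add_assoc]
      linear_combination h₁ - h₂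
  have hDn : D n = D 0 := by simp [hD]
  have hDl := eq_pow_mul_of_forall_eq_mul (f := D) (q := p) (a := l) (k := n - l)
    fun j h₁ h₂ => hout j h₁ (by have := h.lt; omega)
  rw [Nat.add_sub_cancel' h.lt.le, hDn] at hDl
  have hpow : (p : ℤ) ^ l * (p : ℤ) ^ (n - l) = (p : ℤ) ^ n := by
    rw [← pow_add, Nat.add_sub_cancel' h.lt.le]
  simp only [zero_add, Nat.cast_zero, add_zero, h.add_eq] at hin
  have hDr : ((p : ℤ) ^ n - 1) * D 0 = 2 * ((p : ℤ) ^ l * pExpr p T s x - pExpr p T r x) := by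
    linear_combination -hin - (p : ℤ) ^ l * hDl - D 0 * hpow
  rcases eq_or_ne d r with rfl | hdr
  · refine ⟨0, fun _ => rfl, ?_⟩
    simpa [hD] using hDr
  · have hval : r + (((d - r).val : ℕ) : ZMod n) = d := by
      rw [ZMod.natCast_zmod_val]; ring
    have hlt := (d - r).val_lt
    have hpos : 0 < (d - r).val :=
      Nat.pos_of_ne_zero fun h => hdr (sub_eq_zero.1 ((ZMod.val_eq_zero _).1 h))
    have hge : l ≤ (d - r).val := by
      by_contra! hlt'
      exact h.notMem _ hpos hlt' (hval.symm ▸ hd)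
    have hDd := eq_pow_mul_of_forall_eq_mul (f := D) (q := p) (a := (d - r).val)
      (k := n - (d - r).val) fun j h₁ h₂ => hout j (hge.trans h₁) (by omega)
    rw [Nat.add_sub_cancel' hlt.le, hDn] at hDd
    refine ⟨n - (d - r).val, fun h => absurd h hdr, ?_⟩
    have : D (d - r).val = pExpr p T d x - pExpr p T' d x := by simp only [hD, hval]
    rw [← this]
    linear_combination ((p : ℤ) ^ n - 1) * hDd + (p : ℤ) ^ (n - (d - r).val) * hDr

/-- The set `Φ_R(S ∖ {s})` in terms of `T = Φ_R(S)`, for `|S| ≥ 2`. -/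
lemma exists_erase_signSet {n : ℕ} [NeZero n] {R S T : Finset (ZMod n)} {s r : ZMod n} {l : ℕ}
    (h : IsNext S r s l) (hTadm : Admissible R S T) (hTpos : ∀ i ∈ S, IPositive R T i) :
    ∃ T', (T' = if s ∈ T then T else symmDiff T (cyclicBlock r l)) ∧
      Admissible R (S.erase s) T' ∧ ∀ i ∈ S.erase s, IPositive R T' i := by
  refine ⟨_, rfl, ?_⟩
  split_ifs with hs
  · exact ⟨hTadm.erase_of_mem (hTpos s h.right_mem) hs,
      fun i hi => hTpos i (Finset.mem_of_mem_erase hi)⟩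
  · refine ⟨hTadm.erase_symmDiff (hTpos s h.right_mem) h hs, fun i hi => ?_⟩
    obtain ⟨his, hi⟩ := Finset.mem_erase.1 hi
    exact (hTpos i hi).symmDiff h hi his

lemma mem_adapCone_of_forall_erase {p : ℕ} (hp : 2 ≤ p) {n : ℕ} [NeZero n]
    {S T : Finset (ZMod n)} (hS : 1 < S.card) {x : ZMod n → ℤ}
    (hx : ∀ r s l, IsNext S r s l →
      x ∈ adapCone p (S.erase s) (fun _ => if s ∈ T then T else symmDiff T (cyclicBlock r l))) :
    x ∈ adapCone p S (fun _ => T) := by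
  obtain ⟨r, hr, hmax⟩ := S.exists_max_image (fun i => pExpr p T i x)
    (Finset.card_pos.1 (by omega))
  suffices hle : pExpr p T r x ≤ 0 from fun i hi => (hmax i hi).trans hle
  obtain ⟨s, l, h⟩ := exists_isNext_right hS hr
  have hxr := hx r s l h r (Finset.mem_erase.2 ⟨h.ne, hr⟩)
  split_ifs at hxr with hs
  · exact hxr
  · obtain ⟨a, ha, heq⟩ := pExpr_symmDiff p (T := T) h hr x
    rw [ha rfl, pow_zero, mul_one] at heq
    by_contra! hpos
    have hq := one_lt_natCast_pow (n := n) hp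
    have hmaxs := hmax s h.right_mem
    have hlp : 2 * (p : ℤ) ^ l ≤ (p : ℤ) ^ n := by
      obtain ⟨k, rfl⟩ := Nat.exists_eq_add_of_lt h.lt
      have h1 : (1 : ℤ) ≤ (p : ℤ) ^ k := one_le_pow₀ (by exact_mod_cast (by omega : 1 ≤ p))
      have h2 : (2 : ℤ) ≤ p := by exact_mod_cast hp
      have h3 : (0 : ℤ) ≤ (p : ℤ) ^ l := by positivity
      calc 2 * (p : ℤ) ^ l ≤ ((p : ℤ) ^ k * p) * (p : ℤ) ^ l :=
            mul_le_mul_of_nonneg_right (by nlinarith) h3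
        _ = (p : ℤ) ^ (l + k + 1) := by ring
    have h1 : 2 * (p : ℤ) ^ l * pExpr p T s x ≤ (p : ℤ) ^ n * pExpr p T r x :=
      (mul_le_mul_of_nonneg_left hmaxs (by positivity)).trans
        (mul_le_mul_of_nonneg_right hlp hpos.le)
    have h2 := mul_nonpos_of_nonneg_of_nonpos (by linarith : 0 ≤ (p : ℤ) ^ n - 1) hxr
    linarith

lemma mem_adapCone_erase_of_eq_zero {p : ℕ} (hp : 2 ≤ p) {n : ℕ} [NeZero n]
    {S T : Finset (ZMod n)} {r s : ZMod n} {l : ℕ} (h : IsNext S r s l) {x : ZMod n → ℤ}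
    (hx : x ∈ adapCone p S (fun _ => T)) (hzero : s ∉ T → pExpr p T s x = 0) :
    x ∈ adapCone p (S.erase s) (fun _ => if s ∈ T then T else symmDiff T (cyclicBlock r l)) := by
  intro d hd
  obtain ⟨-, hd⟩ := Finset.mem_erase.1 hd
  split_ifs with hs
  · exact hx d hd
  · obtain ⟨a, -, heq⟩ := pExpr_symmDiff p (T := T) h hd x
    rw [hzero hs, mul_zero, zero_sub] at heq
    have hq := one_lt_natCast_pow (n := n) hp
    have hr := hx r h.left_mem
    have hnn : 0 ≤ 2 * (p : ℤ) ^ a * -pExpr p T r x :=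
      mul_nonneg (by positivity) (by simpa using hr)
    have := nonneg_of_mul_nonneg_right (heq ▸ hnn) (by linarith : 0 < (p : ℤ) ^ n - 1)
    linarith [hx d hd]

/-- Subtracting partial Hasse invariants from a multiple of `x` in the homogeneous cone, one can
make the forms `F_T^{(s)}` with `s ∈ S ∖ T` vanish. -/
lemma exists_CpHa_add {p : ℕ} (hp : 2 ≤ p) {n : ℕ} [NeZero n] {R S T : Finset (ZMod n)}
    (hTpos : ∀ i ∈ S, IPositive R T i) {x : ZMod n → ℤ}
    (hx : x ∈ adapCone p S (fun _ => T)) :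
    ∃ m : ℕ, 1 ≤ m ∧ ∃ y ∈ CpHa p R S, ∃ z ∈ adapCone p S (fun _ => T),
      (∀ s ∈ S, s ∉ T → pExpr p T s z = 0) ∧ y + z = (m : ℤ) • x := by
  have hq := one_lt_natCast_pow (n := n) hp
  obtain ⟨m, hm⟩ := Int.eq_ofNat_of_zero_le (by linarith : 0 ≤ (p : ℤ) ^ n - 1)
  set c : ZMod n → ℤ := fun i => if i ∈ S \ T then -pExpr p T i x else 0 with hc
  set y := ∑ i, c i • haVec p R S i with hy
  have hFy : ∀ d ∈ S, pExpr p T d y = if d ∈ T then 0 else ((p : ℤ) ^ n - 1) * pExpr p T d x := by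
    intro d hd
    rw [hy, pExpr_sum_haVec, Finset.sum_eq_single_of_mem d (Finset.mem_univ d)]
    · by_cases hdT : d ∈ T
      · simp [hc, hdT]
      · rw [pExpr_haVec_self p (hTpos d hd) hd]
        simp only [hc, Finset.mem_sdiff, hd, hdT, sgn, if_false, not_false_eq_true, and_self,
          if_true]
        ring
    · intro i _ hid
      by_cases hi : i ∈ S \ T
      · obtain ⟨hiS, hiT⟩ := Finset.mem_sdiff.1 hi
        rw [pExpr_haVec_of_mem_of_ne p (hTpos i hiS) hiS hid, sgn, if_neg hiT]
        ring
      · simp only [hc, if_neg hi, zero_mul]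
  have hFz : ∀ d ∈ S, pExpr p T d ((m : ℤ) • x - y) =
      if d ∈ T then ((p : ℤ) ^ n - 1) * pExpr p T d x else 0 := by
    intro d hd
    rw [← pExprHom_apply, map_sub, map_smul, pExprHom_apply, pExprHom_apply, hFy d hd,
      smul_eq_mul, hm]
    split_ifs <;> ring
  refine ⟨m, by omega, y, ⟨1, le_rfl, c, fun i hi => ?_, by simp [hy]⟩, (m : ℤ) • x - y, ?_,
    fun s hs hsT => by rw [hFz s hs, if_neg hsT], add_sub_cancel _ _⟩
  · simp only [hc]
    split_ifs
    · simpa using hx i hi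
    · exact le_rfl
  · intro d hd
    rw [hFz d hd]
    split_ifs
    · exact mul_nonpos_of_nonneg_of_nonpos (by linarith) (hx d hd)
    · exact le_rfl

lemma ISConeAux_eq_adapCone {p : ℕ} (hp : 2 ≤ p) {n : ℕ} [NeZero n] (R : Finset (ZMod n)) (k : ℕ) :
    ∀ S T : Finset (ZMod n), S.card = k + 1 → Admissible R S T → (∀ i ∈ S, IPositive R T i) →
      ISConeAux p R (k + 1) S = adapCone p S (fun _ => T) := by
  induction k with
  | zero =>
    intro S T hcard hTadm hTpos
    refine (CpHa_subset_adapCone hp hTadm hTpos).antisymm ?_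
    obtain ⟨s, rfl⟩ := Finset.card_eq_one.1 hcard
    exact adapCone_singleton_subset_CpHa hp hTadm (hTpos s (Finset.mem_singleton_self s))
  | succ k ih =>
    intro S T hcard hTadm hTpos
    have hS : 1 < S.card := by omega
    have herase : ∀ r s l, IsNext S r s l → ISConeAux p R (k + 1) (S.erase s) =
        adapCone p (S.erase s) (fun _ => if s ∈ T then T else symmDiff T (cyclicBlock r l)) := by
      intro r s l h
      obtain ⟨T', rfl, hadm, hpos⟩ := exists_erase_signSet h hTadm hTpos
      exact ih _ _ (by rw [Finset.card_erase_of_mem h.right_mem]; omega) hadm hpos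
    rw [ISConeAux]
    apply subset_antisymm
    · refine (satur_mono ?_).trans (satur_adapCone_subset p S _)
      rintro _ ⟨y, hy, z, hz, rfl⟩
      refine adapCone_add_mem (CpHa_subset_adapCone hp hTadm hTpos hy)
        (mem_adapCone_of_forall_erase hp hS fun r s l h => ?_)
      rw [← herase r s l h]
      exact Set.mem_iInter₂.1 hz s h.right_mem
    · intro x hx
      obtain ⟨m, hm, y, hy, z, hz, hzero, heq⟩ := exists_CpHa_add hp hTpos hx
      refine ⟨m, hm, y, hy, z, Set.mem_iInter₂.2 fun s hs => ?_, heq⟩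
      obtain ⟨r, l, h⟩ := exists_isNext_left hS hs
      rw [herase r s l h]
      exact mem_adapCone_erase_of_eq_zero hp h hz (hzero s hs)

/-- Theorem C: for every parabolic type `R ⊆ E_n` and every nonempty `S ⊆ E_n`, the
intersection-sum cone `𝒞_S^{∩,+}` coincides with `𝒞_{R,S}`, the unique positive admissible
homogeneous `S`-adapted `p`-cone (given by the unique `T = Φ_R(S)` which is admissible and
`i`-positive for all `i ∈ S`). -/
theorem ISCone_eq_homogeneous (p : ℕ) (hp : p.Prime) {n : ℕ} [NeZero n]
    (R S : Finset (ZMod n)) (hS : S.Nonempty) (T : Finset (ZMod n))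
    (hTadm : Admissible R S T) (hTpos : ∀ i ∈ S, IPositive R T i) :
    ISCone p R S = adapCone p S (fun _ => T) := by
  obtain ⟨k, hk⟩ := Nat.exists_eq_succ_of_ne_zero (Finset.card_pos.2 hS).ne'
  rw [ISCone, hk]
  exact ISConeAux_eq_adapCone hp.two_le R k S T hk hTadm hTpos
end
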